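/- Let F be a non-degenerate quadratic form in 4 variables over 𝔽_q[t] and let ε > 0. There exist a threshold Q₀(ε,F) and, for each of the four square classes ξ of K_∞^×/(K_∞^×)², a constant C_ξ ≥ 0 with the following property: for all delta-method data (f, g, λ) with q^Q ≥ Q₀(ε,F) and f lying in the class ξ, and all monic r ∈ 𝔽_q[t] with 1 ≤ |r| ≤ q^{Q(1−ε)}, one has I_{g,r}(0⃗) = C_ξ·q^{4Q}. Moreover C_ξ > 0 provided the equation F(x⃗) = f admits a solution x⃗ ∈ K_∞⁴ with |x⃗|² ≤ |f|. -/

import Mathlib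

open Polynomial MeasureTheory
open scoped Classical
noncomputable section
variable (Fq : Type) [Field Fq] [Fintype Fq]
abbrev Kinf := LaurentSeries Fq
def tK : Kinf Fq := HahnSeries.single (-1 : ℤ) 1
def polyToK : Polynomial Fq →+* Kinf Fq := Polynomial.eval₂RingHom HahnSeries.C (tK Fq)
def absK (α : Kinf Fq) : ℝ :=
  if α = 0 then 0 else (Fintype.card Fq : ℝ) ^ (-(HahnSeries.order α))
def eFq (a : Fq) : ℂ :=
  letI : Algebra (ZMod (ringChar Fq)) Fq := ZMod.algebra _ _
  Complex.exp (2 * Real.pi * Complex.I *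
    (((ZMod.val (Algebra.trace (ZMod (ringChar Fq)) Fq a)) : ℂ) / (ringChar Fq : ℂ)))
def psiK (α : Kinf Fq) : ℂ := eFq Fq (α.coeff 1)
def polysLT (d : ℕ) : Finset (Polynomial Fq) :=
  (Finset.univ : Finset (Fin d → Fq)).image fun c =>
    ∑ i : Fin d, Polynomial.C (c i) * Polynomial.X ^ (i : ℕ)
def psirP (r x : Polynomial Fq) : ℂ := psiK Fq (polyToK Fq x / polyToK Fq r)
def coprimeReps (r : Polynomial Fq) : Finset (Polynomial Fq) :=
  (polysLT Fq r.natDegree).filter fun x => IsCoprime x r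
def KinfMS : MeasurableSpace (Kinf Fq) :=
  MeasurableSpace.generateFrom
    {s : Set (Kinf Fq) | ∃ (a : Kinf Fq) (n : ℤ),
      s = {x | absK Fq (x - a) < (Fintype.card Fq : ℝ) ^ n}}
def IsHaar (μ : @Measure (Kinf Fq) (KinfMS Fq)) : Prop :=
  (∀ (a : Kinf Fq) (s : Set (Kinf Fq)), μ ((a + ·) ⁻¹' s) = μ s) ∧
    μ {x : Kinf Fq | absK Fq x < 1} = 1
def hwt (x y : Kinf Fq) : ℝ := if absK Fq y < absK Fq x then (absK Fq x)⁻¹ else 0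
def normV (x : Fin 4 → Kinf Fq) : ℝ :=
  Finset.univ.sup' Finset.univ_nonempty fun i => absK Fq (x i)

/-- The quadratic form `F(x⃗) = x⃗ᵀAx⃗` on polynomial quadruples. -/
def FAP (A : Matrix (Fin 4) (Fin 4) (Polynomial Fq)) (u : Fin 4 → Polynomial Fq) :
    Polynomial Fq := ∑ i, ∑ j, A i j * u i * u j

/-- The quadratic form `F(x⃗) = x⃗ᵀAx⃗` on `K_∞⁴`. -/
def FAK (A : Matrix (Fin 4) (Fin 4) (Polynomial Fq)) (v : Fin 4 → Kinf Fq) : Kinf Fq :=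
  ∑ i, ∑ j, polyToK Fq (A i j) * v i * v j

/-- `R = ⌊deg f/2⌋ − deg g + 1`. -/
def Rdeg (f g : Polynomial Fq) : ℤ := ((f.natDegree / 2 : ℕ) : ℤ) - (g.natDegree : ℤ) + 1

/-- `Q = R + 1`. -/
def Qdeg (f g : Polynomial Fq) : ℤ := Rdeg Fq f g + 1

/-- `k = (f − F(λ))/g`. -/
def kdatA (A : Matrix (Fin 4) (Fin 4) (Polynomial Fq)) (g f : Polynomial Fq)
    (lam : Fin 4 → Polynomial Fq) : Polynomial Fq := (f - FAP Fq A lam) / g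

/-- `G(t⃗) = F(t⃗) + (2λᵀAt⃗ − k)/g`. -/
def GfunA (A : Matrix (Fin 4) (Fin 4) (Polynomial Fq)) (g f : Polynomial Fq)
    (lam : Fin 4 → Polynomial Fq) (v : Fin 4 → Kinf Fq) : Kinf Fq :=
  FAK Fq A v + (polyToK Fq g)⁻¹ *
    (2 * (∑ i, ∑ j, polyToK Fq (lam i * A i j) * v j) - polyToK Fq (kdatA Fq A g f lam))

/-- The weight `w`: indicator of `|x⃗|² ≤ |f|`. -/
def wInd (f : Polynomial Fq) (x : Fin 4 → Kinf Fq) : ℝ :=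
  if (normV Fq x) ^ 2 ≤ absK Fq (polyToK Fq f) then 1 else 0

/-- The oscillatory integral `I_{g,r}(c⃗)`. -/
def IgrA (μ : @Measure (Kinf Fq) (KinfMS Fq)) (A : Matrix (Fin 4) (Fin 4) (Polynomial Fq))
    (g f : Polynomial Fq) (lam : Fin 4 → Polynomial Fq) (r : Polynomial Fq)
    (c : Fin 4 → Polynomial Fq) : ℂ :=
  letI := KinfMS Fq
  ∫ v : Fin 4 → Kinf Fq,
    (((hwt Fq (polyToK Fq r / tK Fq ^ Qdeg Fq f g)
          (GfunA Fq A g f lam v / tK Fq ^ (2 * Qdeg Fq f g)) *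
        wInd Fq f (fun i => polyToK Fq g * v i + polyToK Fq (lam i)) : ℝ) : ℂ) *
      psiK Fq ((∑ i, polyToK Fq (c i) * v i) / (polyToK Fq g * polyToK Fq r)))
    ∂(Measure.pi fun _ : Fin 4 => μ)

/-- The exponential sum `S_{g,r}(c⃗)`. -/
def SgrA (A : Matrix (Fin 4) (Fin 4) (Polynomial Fq)) (g f : Polynomial Fq)
    (lam : Fin 4 → Polynomial Fq) (r : Polynomial Fq) (c : Fin 4 → Polynomial Fq) : ℂ :=
  ∑ l ∈ polysLT Fq g.natDegree, ∑ a ∈ coprimeReps Fq r,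
    ∑ b ∈ Fintype.piFinset (fun _ : Fin 4 => polysLT Fq (g * r).natDegree),
      psirP Fq (g * r)
        ((a + r * l) * (2 * (∑ i, ∑ j, lam i * A i j * b j) - kdatA Fq A g f lam)
          + a * g * FAP Fq A b - ∑ i, c i * b i)

section LocalField

variable {Fq}

lemma one_lt_card_real : (1 : ℝ) < Fintype.card Fq := by
  exact_mod_cast Fintype.one_lt_card

lemma card_real_pos : (0 : ℝ) < Fintype.card Fq := zero_lt_one.trans one_lt_card_real

lemma absK_of_ne_zero {x : Kinf Fq} (hx : x ≠ 0) :
    absK Fq x = (Fintype.card Fq : ℝ) ^ (-x.order) := if_neg hx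

/-- The absolute value on `K_∞` as a homomorphism of monoids with zero. -/
def absKHom : Kinf Fq →*₀ ℝ where
  toFun := absK Fq
  map_zero' := by simp [absK]
  map_one' := by simp [absK]
  map_mul' x y := by
    by_cases hx : x = 0
    · simp [absK, hx]
    by_cases hy : y = 0
    · simp [absK, hy]
    rw [absK_of_ne_zero hx, absK_of_ne_zero hy, absK_of_ne_zero (mul_ne_zero hx hy),
      HahnSeries.order_mul hx hy, neg_add, zpow_add₀ card_real_pos.ne']

lemma absK_zero : absK Fq 0 = 0 := map_zero absKHom

lemma absK_mul (x y : Kinf Fq) : absK Fq (x * y) = absK Fq x * absK Fq y := map_mul absKHom x y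

lemma absK_div (x y : Kinf Fq) : absK Fq (x / y) = absK Fq x / absK Fq y := map_div₀ absKHom x y

lemma absK_inv (x : Kinf Fq) : absK Fq x⁻¹ = (absK Fq x)⁻¹ := map_inv₀ absKHom x

lemma absK_pow (x : Kinf Fq) (n : ℕ) : absK Fq (x ^ n) = absK Fq x ^ n := map_pow absKHom x n

lemma absK_zpow (x : Kinf Fq) (n : ℤ) : absK Fq (x ^ n) = absK Fq x ^ n := map_zpow₀ absKHom x n

lemma absK_nonneg (x : Kinf Fq) : 0 ≤ absK Fq x := by
  unfold absK
  split_ifs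
  · exact le_rfl
  · exact zpow_nonneg card_real_pos.le _

lemma exists_absK_eq_zpow {x : Kinf Fq} (hx : x ≠ 0) :
    ∃ k : ℤ, absK Fq x = (Fintype.card Fq : ℝ) ^ k := ⟨_, absK_of_ne_zero hx⟩

lemma tK_ne_zero : tK Fq ≠ 0 := HahnSeries.single_ne_zero one_ne_zero

lemma absK_tK : absK Fq (tK Fq) = Fintype.card Fq := by
  rw [absK_of_ne_zero tK_ne_zero, tK, HahnSeries.order_single one_ne_zero]
  simp

variable (Fq) in
/-- The ball `{x : |x| < q^n}` as an additive subgroup of `K_∞`. -/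
def ballK (n : ℤ) : AddSubgroup (Kinf Fq) where
  carrier := {x | ∀ i ≤ -n, x.coeff i = 0}
  zero_mem' := by simp
  add_mem' {x y} hx hy i hi := by simp [hx i hi, hy i hi]
  neg_mem' {x} hx i hi := by simp [hx i hi]

lemma mem_ballK_iff_coeff {n : ℤ} {x : Kinf Fq} :
    x ∈ ballK Fq n ↔ ∀ i ≤ -n, x.coeff i = 0 := Iff.rfl

lemma mem_ballK {n : ℤ} {x : Kinf Fq} :
    x ∈ ballK Fq n ↔ absK Fq x < (Fintype.card Fq : ℝ) ^ n := by
  by_cases hx : x = 0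
  · simp [hx, absK_zero, zpow_pos card_real_pos n, zero_mem]
  rw [absK_of_ne_zero hx, zpow_lt_zpow_iff_right₀ one_lt_card_real, mem_ballK_iff_coeff]
  have := HahnSeries.le_order_iff_forall (i := -n + 1) hx
  simp only [Int.lt_add_one_iff] at this
  rw [← this]
  omega

lemma mem_ballK_iff_le {n : ℤ} {x : Kinf Fq} :
    x ∈ ballK Fq n ↔ absK Fq x ≤ (Fintype.card Fq : ℝ) ^ (n - 1) := by
  rw [mem_ballK]
  by_cases hx : x = 0
  · simp [hx, absK_zero, zpow_pos card_real_pos n, zpow_nonneg card_real_pos.le]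
  rw [absK_of_ne_zero hx, zpow_lt_zpow_iff_right₀ one_lt_card_real,
    zpow_le_zpow_iff_right₀ one_lt_card_real]
  omega

lemma ballK_mono : Monotone (ballK Fq) := fun _ _ h _ hx i hi => hx i (by omega)

lemma exists_mem_ballK (x : Kinf Fq) : ∃ n : ℕ, x ∈ ballK Fq n := by
  obtain ⟨n, hn⟩ := pow_unbounded_of_one_lt (absK Fq x) (one_lt_card_real (Fq := Fq))
  exact ⟨n, mem_ballK.2 (by simpa using hn)⟩

lemma mul_mem_ballK_iff {a x : Kinf Fq} {k n : ℤ} (ha : absK Fq a = (Fintype.card Fq : ℝ) ^ k) :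
    a * x ∈ ballK Fq n ↔ x ∈ ballK Fq (n - k) := by
  rw [mem_ballK, mem_ballK, absK_mul, ha, zpow_sub₀ card_real_pos.ne',
    lt_div_iff₀ (zpow_pos card_real_pos k), mul_comm]

lemma mul_mem_ballK {a x : Kinf Fq} {k n : ℤ} (ha : absK Fq a ≤ (Fintype.card Fq : ℝ) ^ k)
    (hx : x ∈ ballK Fq n) : a * x ∈ ballK Fq (n + k) := by
  rw [mem_ballK_iff_le] at hx ⊢
  rw [absK_mul, show n + k - 1 = k + (n - 1) by ring, zpow_add₀ card_real_pos.ne']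
  exact mul_le_mul ha hx (absK_nonneg _) (zpow_nonneg card_real_pos.le _)

/-- Each element of `{|x| < q^n}` has a unique leading coefficient at `t^(n-1)`. -/
lemma sub_single_mem_ballK_iff {n : ℤ} {x : Kinf Fq} {a : Fq} :
    x - HahnSeries.single (1 - n) a ∈ ballK Fq (n - 1) ↔
      x ∈ ballK Fq n ∧ x.coeff (1 - n) = a := by
  simp only [mem_ballK_iff_coeff, HahnSeries.coeff_sub, HahnSeries.coeff_single]
  constructor
  · refine fun h => ⟨fun i hi => ?_, ?_⟩
    · simpa [show i ≠ 1 - n by omega] using h i (by omega)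
    · simpa [sub_eq_zero] using h (1 - n) (by omega)
  · rintro ⟨h, rfl⟩ i hi
    by_cases hin : i = 1 - n
    · simp [hin]
    · simp [hin, h i (by omega)]

/-- One-units are squares of elements of absolute value one. -/
lemma exists_sq_eq_of_sub_one_mem (h2 : (2 : Fq) ≠ 0) {x : Kinf Fq} (hx : x - 1 ∈ ballK Fq 0) :
    ∃ u : Kinf Fq, absK Fq u = 1 ∧ u ^ 2 = x := by
  have hcoeff : ∀ i ≤ 0, x.coeff i = (1 : Kinf Fq).coeff i := fun i hi => by
    have := hx i (by simpa using hi)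
    rwa [HahnSeries.coeff_sub, sub_eq_zero] at this
  let p : PowerSeries Fq := PowerSeries.mk fun n => x.coeff n
  have hp : (p : Kinf Fq) = x := by
    ext i
    rcases lt_or_ge i 0 with hi | hi
    · rw [PowerSeries.coeff_coe, if_pos hi, hcoeff i hi.le, HahnSeries.coeff_one, if_neg hi.ne]
    · obtain ⟨n, rfl⟩ := Int.eq_ofNat_of_zero_le hi
      simp [p, PowerSeries.coeff_coe]
  have h0 : PowerSeries.constantCoeff p = 1 := by
    rw [← PowerSeries.coeff_zero_eq_constantCoeff_apply, PowerSeries.coeff_mk]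
    simpa using hcoeff 0 le_rfl
  obtain ⟨u, hu, -⟩ := HenselianRing.is_henselian (I := Ideal.span {(PowerSeries.X : PowerSeries Fq)})
    (X ^ 2 - C p) (monic_X_pow_sub_C p two_ne_zero) 1
    (by
      rw [Ideal.mem_span_singleton, PowerSeries.X_dvd_iff]
      simp [h0])
    (by
      apply IsUnit.map
      rw [PowerSeries.isUnit_iff_constantCoeff]
      simpa [one_add_one_eq_two, map_ofNat] using h2)
  have hu2 : u ^ 2 = p := by simpa [sub_eq_zero] using hu
  have hxu : (u : Kinf Fq) ^ 2 = x := by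
    rw [← hp, ← hu2, map_pow]
  refine ⟨u, ?_, hxu⟩
  have hx1 : absK Fq x = 1 := by
    have hx0 : x.coeff 0 ≠ 0 := by simp [hcoeff 0 le_rfl]
    have hxne : x ≠ 0 := by
      rintro rfl
      simp at hx0
    have h1 := HahnSeries.order_le_of_coeff_ne_zero hx0
    have h2 : (0 : ℤ) ≤ x.order := (HahnSeries.le_order_iff_forall hxne).2 fun i hi => by
      rw [hcoeff i hi.le, HahnSeries.coeff_one, if_neg hi.ne]
    rw [absK_of_ne_zero hxne, le_antisymm h1 h2]
    simp
  rw [← hxu, absK_pow] at hx1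
  exact (pow_eq_one_iff_of_nonneg (absK_nonneg _) two_ne_zero).1 hx1

lemma coeff_polyToK (f : Polynomial Fq) (i : ℤ) :
    (polyToK Fq f).coeff i = ∑ n ∈ f.support, if i = -(n : ℤ) then f.coeff n else 0 := by
  have h : polyToK Fq f = ∑ n ∈ f.support, HahnSeries.single (-(n : ℤ)) (f.coeff n) := by
    rw [polyToK, coe_eval₂RingHom, eval₂_eq_sum, Polynomial.sum]
    refine Finset.sum_congr rfl fun n _ => ?_
    rw [tK, HahnSeries.single_pow, HahnSeries.C_apply, HahnSeries.single_mul_single]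
    simp
  rw [h, HahnSeries.coeff_sum]
  refine Finset.sum_congr rfl fun n _ => ?_
  rw [HahnSeries.coeff_single]
  congr

lemma absK_polyToK {f : Polynomial Fq} (hf : f ≠ 0) :
    absK Fq (polyToK Fq f) = (Fintype.card Fq : ℝ) ^ (f.natDegree : ℤ) := by
  have hlead : (polyToK Fq f).coeff (-(f.natDegree : ℤ)) ≠ 0 := by
    rw [coeff_polyToK, Finset.sum_eq_single_of_mem f.natDegree (natDegree_mem_support_of_nonzero hf)
      fun n _ hn => if_neg (by simpa using hn.symm)]
    simpa using hf
  have hne : polyToK Fq f ≠ 0 := fun h => hlead (by simp [h])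
  have hle : -(f.natDegree : ℤ) ≤ (polyToK Fq f).order :=
    (HahnSeries.le_order_iff_forall hne).2 fun i hi => by
      rw [coeff_polyToK]
      refine Finset.sum_eq_zero fun n hn => if_neg ?_
      have := le_natDegree_of_mem_supp n hn
      omega
  rw [absK_of_ne_zero hne, le_antisymm (HahnSeries.order_le_of_coeff_ne_zero hlead) hle, neg_neg]

lemma polyToK_ne_zero {f : Polynomial Fq} (hf : f ≠ 0) : polyToK Fq f ≠ 0 := by
  intro h
  have := absK_polyToK hf
  rw [h, absK_zero] at this
  exact (zpow_pos card_real_pos _).ne this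

section Measure

attribute [local instance] KinfMS

open scoped ENNReal

lemma measurableSet_sub_mem_ballK (a : Kinf Fq) (n : ℤ) :
    MeasurableSet {x : Kinf Fq | x - a ∈ ballK Fq n} :=
  MeasurableSpace.measurableSet_generateFrom ⟨a, n, by simp only [mem_ballK]⟩

lemma measurable_mul_add {a : Kinf Fq} (ha : a ≠ 0) (b : Kinf Fq) :
    Measurable fun x : Kinf Fq => a * x + b := by
  obtain ⟨k, hk⟩ := exists_absK_eq_zpow ha
  refine measurable_generateFrom ?_
  rintro _ ⟨c, n, rfl⟩
  convert measurableSet_sub_mem_ballK ((c - b) / a) (n - k) using 1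
  ext x
  rw [Set.mem_preimage, Set.mem_ofPred_eq, Set.mem_ofPred_eq, ← mem_ballK, ← mul_mem_ballK_iff hk,
    mul_sub, mul_div_cancel₀ _ ha]
  ring_nf

lemma card_ennreal_ne_zero : (Fintype.card Fq : ℝ≥0∞) ≠ 0 := by simp

lemma card_ennreal_ne_top : (Fintype.card Fq : ℝ≥0∞) ≠ ∞ := ENNReal.natCast_ne_top _

lemma toReal_card_zpow (n : ℤ) :
    ((Fintype.card Fq : ℝ≥0∞) ^ n).toReal = (Fintype.card Fq : ℝ) ^ n := by
  cases n <;> simp [zpow_negSucc]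

variable {μ : Measure (Kinf Fq)}

lemma IsHaar.measure_sub_mem_ballK_eq (hμ : IsHaar Fq μ) (a : Kinf Fq) (n : ℤ) :
    μ {x | x - a ∈ ballK Fq n} = μ (ballK Fq n) := by
  rw [← hμ.1 (-a) (ballK Fq n)]
  congr 1
  ext x
  simp [sub_eq_neg_add]

lemma IsHaar.measure_ballK_succ (hμ : IsHaar Fq μ) (n : ℤ) :
    μ (ballK Fq (n + 1)) = Fintype.card Fq * μ (ballK Fq n) := by
  have h : (ballK Fq (n + 1) : Set (Kinf Fq)) =
      ⋃ a : Fq, {x | x - HahnSeries.single (1 - (n + 1)) a ∈ ballK Fq n} := by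
    ext x
    have := fun a => sub_single_mem_ballK_iff (n := n + 1) (x := x) (a := a)
    simp only [add_sub_cancel_right] at this
    simp only [Set.mem_iUnion, Set.mem_ofPred_eq, SetLike.mem_coe, this, exists_and_left,
      exists_eq', and_true]
  rw [h, measure_iUnion ?_ fun a => measurableSet_sub_mem_ballK _ _]
  · simp [hμ.measure_sub_mem_ballK_eq, tsum_fintype]
  · intro a b hab
    refine Set.disjoint_left.2 fun x hxa hxb => hab ?_
    have := fun a => sub_single_mem_ballK_iff (n := n + 1) (x := x) (a := a)
    simp only [add_sub_cancel_right] at this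
    exact ((this a).1 hxa).2.symm.trans ((this b).1 hxb).2

lemma IsHaar.measure_ballK (hμ : IsHaar Fq μ) (n : ℤ) :
    μ (ballK Fq n) = (Fintype.card Fq : ℝ≥0∞) ^ n := by
  have h0 : μ (ballK Fq 0) = 1 := by
    rw [← hμ.2]
    congr 1
    ext x
    simp [mem_ballK]
  induction n with
  | zero => simpa using h0
  | succ n ih =>
    rw [hμ.measure_ballK_succ, ih, ENNReal.zpow_add card_ennreal_ne_zero card_ennreal_ne_top,
      zpow_one, mul_comm]
  | pred n ih =>
    have h := hμ.measure_ballK_succ (-(n : ℤ) - 1)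
    rw [sub_add_cancel, ih] at h
    rw [ENNReal.zpow_sub card_ennreal_ne_zero card_ennreal_ne_top, h, zpow_one, mul_comm,
      ← mul_assoc, ENNReal.inv_mul_cancel card_ennreal_ne_zero card_ennreal_ne_top, one_mul]

lemma iUnion_ballK : ⋃ n : ℕ, (ballK Fq n : Set (Kinf Fq)) = Set.univ :=
  Set.eq_univ_of_forall fun x => Set.mem_iUnion.2 (exists_mem_ballK x)

lemma IsHaar.sigmaFinite (hμ : IsHaar Fq μ) : SigmaFinite μ :=
  ⟨⟨{ set := fun n => ballK Fq n
      set_mem := fun _ => trivial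
      finite := fun n => by
        rw [hμ.measure_ballK]
        exact (ENNReal.zpow_ne_top card_ennreal_ne_zero card_ennreal_ne_top _).lt_top
      spanning := iUnion_ballK }⟩⟩

lemma isPiSystem_ballK :
    IsPiSystem {s : Set (Kinf Fq) | ∃ (a : Kinf Fq) (n : ℤ),
      s = {x | absK Fq (x - a) < (Fintype.card Fq : ℝ) ^ n}} := by
  rintro _ ⟨a, m, rfl⟩ _ ⟨b, n, rfl⟩ ⟨c, hca, hcb⟩
  simp only [← mem_ballK, Set.mem_ofPred_eq] at hca hcb ⊢
  refine ⟨c, min m n, ?_⟩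
  ext x
  have ha : x - a ∈ ballK Fq m ↔ x - c ∈ ballK Fq m := by
    rw [← sub_add_sub_cancel x c a]
    exact (ballK Fq m).add_mem_cancel_right hca
  have hb : x - b ∈ ballK Fq n ↔ x - c ∈ ballK Fq n := by
    rw [← sub_add_sub_cancel x c b]
    exact (ballK Fq n).add_mem_cancel_right hcb
  simp only [Set.mem_inter_iff, Set.mem_ofPred_eq, ha, hb]
  rcases le_total m n with h | h
  · rw [min_eq_left h]
    exact ⟨fun h' => h'.1, fun h' => ⟨h', ballK_mono h h'⟩⟩
  · rw [min_eq_right h]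
    exact ⟨fun h' => h'.2, fun h' => ⟨ballK_mono h h', h'⟩⟩

lemma IsHaar.map_mul_add (hμ : IsHaar Fq μ) {a : Kinf Fq} {k : ℤ}
    (ha : absK Fq a = (Fintype.card Fq : ℝ) ^ k) (b : Kinf Fq) :
    μ.map (fun x => a * x + b) = (Fintype.card Fq : ℝ≥0∞) ^ (-k) • μ := by
  have ha0 : a ≠ 0 := by
    rintro rfl
    exact (zpow_pos card_real_pos k).ne (absK_zero.symm.trans ha)
  have key : ∀ (c : Kinf Fq) (n : ℤ), μ.map (fun x => a * x + b) {x | x - c ∈ ballK Fq n} =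
      ((Fintype.card Fq : ℝ≥0∞) ^ (-k) • μ) {x | x - c ∈ ballK Fq n} := fun c n => by
    rw [Measure.map_apply (measurable_mul_add ha0 b) (measurableSet_sub_mem_ballK c n),
      Measure.smul_apply, hμ.measure_sub_mem_ballK_eq, smul_eq_mul, hμ.measure_ballK,
      ← ENNReal.zpow_add card_ennreal_ne_zero card_ennreal_ne_top, neg_add_eq_sub,
      ← hμ.measure_ballK, ← hμ.measure_sub_mem_ballK_eq ((c - b) / a)]
    congr 1
    ext x
    rw [Set.mem_preimage, Set.mem_ofPred_eq, Set.mem_ofPred_eq, ← mul_mem_ballK_iff ha,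
      mul_sub, mul_div_cancel₀ _ ha0]
    ring_nf
  refine Measure.ext_of_generateFrom_of_iUnion _ (fun n : ℕ => (ballK Fq n : Set (Kinf Fq))) rfl
    isPiSystem_ballK iUnion_ballK (fun n => ⟨0, n, ?_⟩) (fun n => ?_) ?_
  · ext x
    simp [mem_ballK]
  · have := key 0 n
    simp only [sub_zero] at this
    rw [show (ballK Fq n : Set (Kinf Fq)) = {x | x ∈ ballK Fq n} from rfl, this,
      Measure.smul_apply, smul_eq_mul]
    refine ENNReal.mul_ne_top (ENNReal.zpow_ne_top card_ennreal_ne_zero card_ennreal_ne_top _) ?_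
    change μ (ballK Fq n) ≠ ∞
    rw [hμ.measure_ballK]
    exact ENNReal.zpow_ne_top card_ennreal_ne_zero card_ennreal_ne_top _
  · rintro _ ⟨c, n, rfl⟩
    simpa only [mem_ballK] using key c n

lemma IsHaar.pi_preimage_mul_add (hμ : IsHaar Fq μ) {a : Kinf Fq} {k : ℤ}
    (ha : absK Fq a = (Fintype.card Fq : ℝ) ^ k) (b : Fin 4 → Kinf Fq)
    {S : Set (Fin 4 → Kinf Fq)} (hS : MeasurableSet S) :
    Measure.pi (fun _ : Fin 4 => μ) {v | (fun i => a * v i + b i) ∈ S} =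
      (Fintype.card Fq : ℝ≥0∞) ^ (-(4 * k)) * Measure.pi (fun _ : Fin 4 => μ) S := by
  have := hμ.sigmaFinite
  have ha0 : a ≠ 0 := by
    rintro rfl
    exact (zpow_pos card_real_pos k).ne (absK_zero.symm.trans ha)
  have hne := ENNReal.zpow_ne_top card_ennreal_ne_zero (card_ennreal_ne_top (Fq := Fq)) (-k)
  have hm : ∀ i, Measurable fun x : Kinf Fq => a * x + b i := fun i => measurable_mul_add ha0 _
  have hfin : ∀ i, SigmaFinite (μ.map fun x => a * x + b i) := fun i => by
    rw [hμ.map_mul_add ha]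
    rw [← ENNReal.coe_toNNReal hne]
    exact SMul.sigmaFinite _
  have hmap := Measure.pi_map_pi (μ := fun _ : Fin 4 => μ) (f := fun i x => a * x + b i)
    fun i => (hm i).aemeasurable
  have hsmul : Measure.pi (fun i : Fin 4 => μ.map fun x => a * x + b i) =
      (Fintype.card Fq : ℝ≥0∞) ^ (-(4 * k)) • Measure.pi (fun _ : Fin 4 => μ) := by
    refine Measure.pi_eq fun s _ => ?_
    simp only [hμ.map_mul_add ha, Measure.smul_apply, Measure.pi_pi, smul_eq_mul,
      Finset.prod_mul_distrib, Finset.prod_const, Finset.card_univ, Fintype.card_fin]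
    congr 1
    rw [show -(4 * k) = -k + -k + (-k + -k) by ring]
    simp only [ENNReal.zpow_add card_ennreal_ne_zero (card_ennreal_ne_top (Fq := Fq))]
    ring
  have h := congrArg (fun m => m S) (hmap.trans hsmul)
  simp only [Measure.smul_apply, smul_eq_mul] at h
  have hm' : Measurable fun (v : Fin 4 → Kinf Fq) i => a * v i + b i :=
    measurable_pi_lambda _ fun i => (hm i).comp (measurable_pi_apply i)
  rw [← h, Measure.map_apply hm' hS]
  rfl

/-- Every open subset of `K_∞⁴` is measurable, as `K_∞` is second countable. -/
lemma measurableSet_of_forall_exists_ballK {S : Set (Fin 4 → Kinf Fq)}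
    (hS : ∀ y ∈ S, ∃ n : ℤ, ∀ z, (∀ i, z i - y i ∈ ballK Fq n) → z ∈ S) : MeasurableSet S := by
  let B : (Fin 4 → (ℤ →₀ Fq)) × ℤ → Set (Fin 4 → Kinf Fq) := fun p =>
    {z | ∀ i, z i - HahnSeries.ofFinsupp (p.1 i) ∈ ballK Fq p.2}
  have hB : ∀ p, MeasurableSet (B p) := fun p => by
    simp only [B, Set.ofPred_forall]
    exact MeasurableSet.iInter fun i => (measurable_pi_apply i : Measurable
      fun z : Fin 4 → Kinf Fq => z i) (measurableSet_sub_mem_ballK _ p.2)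
  have hdense : ∀ (x : Kinf Fq) (n : ℤ), ∃ c : ℤ →₀ Fq,
      x - HahnSeries.ofFinsupp c ∈ ballK Fq n := fun x n => by
    refine ⟨Finsupp.onFinset (Finset.Icc x.order (-n))
      (fun i => if i ≤ -n then x.coeff i else 0) fun i hi => ?_, fun i hi => ?_⟩
    · simp only [ne_eq, ite_eq_right_iff, Classical.not_imp] at hi
      exact Finset.mem_Icc.2 ⟨HahnSeries.order_le_of_coeff_ne_zero hi.2, hi.1⟩
    · simp [hi]
  have hSB : S = ⋃ p : {p // B p ⊆ S}, B p := by
    refine Set.Subset.antisymm (fun y hy => ?_) (Set.iUnion_subset fun p => p.2)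
    obtain ⟨n, hn⟩ := hS y hy
    choose c hc using fun i => hdense (y i) n
    refine Set.mem_iUnion.2 ⟨⟨(c, n), fun z hz => hn z fun i => ?_⟩, hc⟩
    have := (ballK Fq n).sub_mem (hz i) (hc i)
    rwa [sub_sub_sub_cancel_right] at this
  rw [hSB]
  exact MeasurableSet.iUnion fun p => hB p

lemma IsHaar.pi_box (hμ : IsHaar Fq μ) (y : Fin 4 → Kinf Fq) (n : ℤ) :
    Measure.pi (fun _ : Fin 4 => μ) {z | ∀ i, z i - y i ∈ ballK Fq n} =
      ((Fintype.card Fq : ℝ≥0∞) ^ n) ^ 4 := by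
  have := hμ.sigmaFinite
  have : {z : Fin 4 → Kinf Fq | ∀ i, z i - y i ∈ ballK Fq n} =
      Set.univ.pi fun i => {x | x - y i ∈ ballK Fq n} := by
    ext z
    simp
  rw [this, Measure.pi_pi]
  simp [hμ.measure_sub_mem_ballK_eq, hμ.measure_ballK]

end Measure

section Density

attribute [local instance] KinfMS

open scoped ENNReal

variable {A : Matrix (Fin 4) (Fin 4) (Polynomial Fq)}

variable (A) in
/-- The integral solutions `y⃗` of `|F(y⃗) − c| < q^n`. -/
def solSet (c : Kinf Fq) (n : ℤ) : Set (Fin 4 → Kinf Fq) :=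
  {y | (∀ i, y i ∈ ballK Fq 1) ∧ FAK Fq A y - c ∈ ballK Fq n}

lemma exists_ballK_forall_mem_solSet {c : Kinf Fq} {n : ℤ} {y : Fin 4 → Kinf Fq}
    (hy : y ∈ solSet A c n) :
    ∃ m : ℤ, ∀ z, (∀ i, z i - y i ∈ ballK Fq m) → z ∈ solSet A c n := by
  choose e he using fun p : Fin 4 × Fin 4 => exists_mem_ballK (polyToK Fq (A p.1 p.2))
  obtain ⟨k, hk⟩ := Finite.exists_le e
  have hA : ∀ i j, absK Fq (polyToK Fq (A i j)) ≤ (Fintype.card Fq : ℝ) ^ (k : ℤ) := fun i j =>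
    (mem_ballK.1 (ballK_mono (by exact_mod_cast hk (i, j)) (he (i, j)))).le
  have hone : ∀ x ∈ ballK Fq 1, absK Fq x ≤ (Fintype.card Fq : ℝ) ^ (0 : ℤ) := fun x hx => by
    simpa using mem_ballK_iff_le.1 hx
  refine ⟨min 1 (n - k), fun z hz => ?_⟩
  have hz1 : ∀ i, z i ∈ ballK Fq 1 := fun i => by
    rw [← sub_add_cancel (z i) (y i)]
    exact add_mem (ballK_mono (min_le_left _ _) (hz i)) (hy.1 i)
  have hzn : ∀ i, z i - y i ∈ ballK Fq (n - k) := fun i => ballK_mono (min_le_right _ _) (hz i)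
  refine ⟨hz1, ?_⟩
  rw [← sub_add_sub_cancel _ (FAK Fq A y)]
  refine add_mem ?_ hy.2
  simp only [FAK, ← Finset.sum_sub_distrib]
  refine sum_mem fun i _ => sum_mem fun j _ => ?_
  have h1 := mul_mem_ballK (hone _ (hz1 i)) (hzn j)
  have h2 := mul_mem_ballK (hone _ (hy.1 j)) (hzn i)
  have h := mul_mem_ballK (hA i j) (add_mem h1 h2)
  rw [add_zero, sub_add_cancel] at h
  convert h using 1
  ring

lemma measurableSet_solSet (c : Kinf Fq) (n : ℤ) : MeasurableSet (solSet A c n) :=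
  measurableSet_of_forall_exists_ballK fun _ => exists_ballK_forall_mem_solSet

lemma FAK_smul (u : Kinf Fq) (y : Fin 4 → Kinf Fq) :
    FAK Fq A (fun i => u * y i) = u ^ 2 * FAK Fq A y := by
  simp only [FAK, Finset.mul_sum]
  exact Finset.sum_congr rfl fun i _ => Finset.sum_congr rfl fun j _ => by ring

variable {μ : Measure (Kinf Fq)}

lemma IsHaar.pi_solSet_mul_sq (hμ : IsHaar Fq μ) {u : Kinf Fq} (hu : absK Fq u = 1)
    (c : Kinf Fq) (n : ℤ) :
    Measure.pi (fun _ : Fin 4 => μ) (solSet A (c * u ^ 2) n) =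
      Measure.pi (fun _ : Fin 4 => μ) (solSet A c n) := by
  have hu0 : absK Fq u = (Fintype.card Fq : ℝ) ^ (0 : ℤ) := by simpa using hu
  have hu2 : absK Fq (u ^ 2) = (Fintype.card Fq : ℝ) ^ (0 : ℤ) := by simp [absK_pow, hu]
  have h := hμ.pi_preimage_mul_add hu0 0 (measurableSet_solSet (A := A) (c * u ^ 2) n)
  simp only [mul_zero, neg_zero, zpow_zero, one_mul] at h
  rw [← h]
  congr 1
  ext v
  simp only [solSet, Set.mem_ofPred_eq, Pi.zero_apply, add_zero, FAK_smul,
    mul_comm c, ← mul_sub, mul_mem_ballK_iff hu0, mul_mem_ballK_iff hu2, sub_zero]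

lemma IsHaar.pi_solSet_eq (hμ : IsHaar Fq μ) (h2 : (2 : Fq) ≠ 0) {c : Kinf Fq}
    (hc : 1 ≤ absK Fq c) {n : ℤ} (hn : n ≤ 0) :
    Measure.pi (fun _ : Fin 4 => μ) (solSet A c n) =
      Fintype.card Fq * Measure.pi (fun _ : Fin 4 => μ) (solSet A c (n - 1)) := by
  have hc0 : c ≠ 0 := by
    rintro rfl
    rw [absK_zero] at hc
    exact absurd hc (by norm_num)
  have hmem : ∀ (y : Fin 4 → Kinf Fq) (a : Fq),
      y ∈ solSet A (c + HahnSeries.single (1 - n) a) (n - 1) ↔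
        y ∈ solSet A c n ∧ (FAK Fq A y - c).coeff (1 - n) = a := fun y a => by
    simp only [solSet, Set.mem_ofPred_eq, ← sub_sub (FAK Fq A y), sub_single_mem_ballK_iff,
      and_assoc]
  have hunion : solSet A c n =
      ⋃ a : Fq, solSet A (c + HahnSeries.single (1 - n) a) (n - 1) := by
    ext y
    simp only [Set.mem_iUnion, hmem, exists_and_left, exists_eq', and_true]
  have hshift : ∀ a : Fq, Measure.pi (fun _ : Fin 4 => μ)
      (solSet A (c + HahnSeries.single (1 - n) a) (n - 1)) =
        Measure.pi (fun _ : Fin 4 => μ) (solSet A c (n - 1)) := fun a => by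
    have hs : (HahnSeries.single (1 - n) a : Kinf Fq) ∈ ballK Fq 0 := fun i hi => by
      rw [HahnSeries.coeff_single, if_neg (by omega)]
    have hmem1 : (1 + HahnSeries.single (1 - n) a / c) - 1 ∈ ballK Fq 0 := by
      rw [add_sub_cancel_left, mem_ballK, absK_div]
      exact (div_le_self (absK_nonneg _) hc).trans_lt (mem_ballK.1 hs)
    obtain ⟨u, hu, hu2⟩ := exists_sq_eq_of_sub_one_mem h2 hmem1
    rw [← hμ.pi_solSet_mul_sq hu c, hu2, mul_add, mul_one, mul_div_cancel₀ _ hc0]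
  rw [hunion, measure_iUnion ?_ fun a => measurableSet_solSet _ _]
  · simp only [hshift, tsum_fintype, Finset.sum_const, Finset.card_univ, nsmul_eq_mul]
  · intro a b hab
    exact Set.disjoint_left.2 fun y hya hyb =>
      hab (((hmem y a).1 hya).2.symm.trans ((hmem y b).1 hyb).2)

lemma IsHaar.pi_solSet_neg_nat (hμ : IsHaar Fq μ) (h2 : (2 : Fq) ≠ 0) {c : Kinf Fq}
    (hc : 1 ≤ absK Fq c) (n : ℕ) :
    Measure.pi (fun _ : Fin 4 => μ) (solSet A c (-(n : ℤ))) =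
      (Fintype.card Fq : ℝ≥0∞) ^ (-(n : ℤ)) *
        Measure.pi (fun _ : Fin 4 => μ) (solSet A c 0) := by
  induction n with
  | zero => simp
  | succ n ih =>
    rw [hμ.pi_solSet_eq h2 hc (by omega : -(n : ℤ) ≤ 0)] at ih
    rw [Nat.cast_succ, neg_add, ← sub_eq_add_neg,
      ENNReal.zpow_sub card_ennreal_ne_zero card_ennreal_ne_top, zpow_one, mul_right_comm, ← ih,
      mul_right_comm, ENNReal.mul_inv_cancel card_ennreal_ne_zero card_ennreal_ne_top, one_mul]

lemma IsHaar.pi_solSet_ne_top (hμ : IsHaar Fq μ) (c : Kinf Fq) (n : ℤ) :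
    Measure.pi (fun _ : Fin 4 => μ) (solSet A c n) ≠ ∞ := by
  have hsub : solSet A c n ⊆ {z | ∀ i, z i - (0 : Fin 4 → Kinf Fq) i ∈ ballK Fq 1} :=
    fun y hy i => by simpa using hy.1 i
  refine measure_ne_top_of_subset hsub ?_
  rw [hμ.pi_box]
  exact ENNReal.pow_ne_top (ENNReal.zpow_ne_top card_ennreal_ne_zero card_ennreal_ne_top _)

lemma IsHaar.pi_solSet_pos (hμ : IsHaar Fq μ) {c : Kinf Fq} {n : ℤ}
    (h : (solSet A c n).Nonempty) : 0 < Measure.pi (fun _ : Fin 4 => μ) (solSet A c n) := by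
  obtain ⟨y, hy⟩ := h
  obtain ⟨m, hm⟩ := exists_ballK_forall_mem_solSet hy
  have hsub : {z : Fin 4 → Kinf Fq | ∀ i, z i - y i ∈ ballK Fq m} ⊆ solSet A c n := hm
  refine lt_of_lt_of_le ?_ (measure_mono hsub)
  rw [hμ.pi_box]
  exact ENNReal.pow_pos (ENNReal.zpow_pos card_ennreal_ne_zero card_ennreal_ne_top m) 4

/-- The normalization `f / t^(2⌊deg f/2⌋)` of `f`, of absolute value `1` or `q`. -/
def normalized (f : Polynomial Fq) : Kinf Fq :=
  polyToK Fq f / tK Fq ^ (2 * (f.natDegree / 2))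

lemma one_le_absK_normalized {f : Polynomial Fq} (hf : f ≠ 0) : 1 ≤ absK Fq (normalized f) := by
  rw [normalized, absK_div, absK_polyToK hf, absK_pow, absK_tK, zpow_natCast,
    one_le_div (pow_pos card_real_pos _)]
  exact pow_le_pow_right₀ one_lt_card_real.le (Nat.mul_div_le _ _)

/-- Multiplying `f` by a square of `K_∞` changes its normalization by the square of a unit. -/
lemma exists_normalized_eq_mul_sq {f f' : Polynomial Fq} (hf : f ≠ 0) (hf' : f' ≠ 0)
    {u : Kinf Fq} (hu : u ≠ 0) (huf : polyToK Fq f = polyToK Fq f' * u ^ 2) :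
    ∃ w : Kinf Fq, absK Fq w = 1 ∧ normalized f = normalized f' * w ^ 2 := by
  obtain ⟨k, hk⟩ := exists_absK_eq_zpow hu
  have hdeg : (f.natDegree : ℤ) = f'.natDegree + k * 2 := by
    have h := congrArg (absK Fq) huf
    rw [absK_mul, absK_pow, absK_polyToK hf, absK_polyToK hf', hk, ← zpow_natCast, ← zpow_mul,
      ← zpow_add₀ card_real_pos.ne'] at h
    exact zpow_right_injective₀ card_real_pos one_lt_card_real.ne' h
  refine ⟨u * tK Fq ^ (f'.natDegree / 2) / tK Fq ^ (f.natDegree / 2), ?_, ?_⟩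
  · rw [absK_div, absK_mul, absK_pow, absK_pow, absK_tK, hk, ← zpow_natCast, ← zpow_natCast,
      ← zpow_add₀ card_real_pos.ne', ← zpow_sub₀ card_real_pos.ne',
      zpow_eq_one_iff_right₀ card_real_pos.le one_lt_card_real.ne']
    omega
  · have ht := tK_ne_zero (Fq := Fq)
    rw [normalized, normalized, huf, mul_comm 2, mul_comm 2, pow_mul, pow_mul]
    field_simp

lemma normV_sq_le_iff {f : Polynomial Fq} (hf : f ≠ 0) (x : Fin 4 → Kinf Fq) :
    normV Fq x ^ 2 ≤ absK Fq (polyToK Fq f) ↔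
      ∀ i, x i ∈ ballK Fq (1 + (f.natDegree / 2 : ℕ)) := by
  have hcoord : ∀ z : Kinf Fq, absK Fq z ^ 2 ≤ absK Fq (polyToK Fq f) ↔
      z ∈ ballK Fq (1 + (f.natDegree / 2 : ℕ)) := fun z => by
    rw [absK_polyToK hf, mem_ballK_iff_le]
    by_cases hz : z = 0
    · simp [hz, absK_zero, zpow_nonneg card_real_pos.le]
    obtain ⟨k, hk⟩ := exists_absK_eq_zpow hz
    rw [hk, ← zpow_natCast, ← zpow_mul, zpow_le_zpow_iff_right₀ one_lt_card_real,
      zpow_le_zpow_iff_right₀ one_lt_card_real]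
    push_cast
    omega
  simp only [← hcoord]
  constructor
  · refine fun h i => le_trans ?_ h
    have := Finset.le_sup' (fun i => absK Fq (x i)) (Finset.mem_univ i)
    exact pow_le_pow_left₀ (absK_nonneg _) this 2
  · intro h
    obtain ⟨i, -, hi⟩ := Finset.exists_mem_eq_sup' Finset.univ_nonempty fun i => absK Fq (x i)
    rw [normV, hi]
    exact h i

/-- Completing the square: `g²G(v⃗) = F(gv⃗ + λ) − f`. -/
lemma sq_mul_GfunA (hsym : A.IsSymm) {g f : Polynomial Fq} (hg : g ≠ 0)
    {lam : Fin 4 → Polynomial Fq} (hdvd : g ∣ f - FAP Fq A lam) (v : Fin 4 → Kinf Fq) :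
    polyToK Fq g ^ 2 * GfunA Fq A g f lam v =
      FAK Fq A (fun i => polyToK Fq g * v i + polyToK Fq (lam i)) - polyToK Fq f := by
  have hk : polyToK Fq g * polyToK Fq (kdatA Fq A g f lam) =
      polyToK Fq f - polyToK Fq (FAP Fq A lam) := by
    rw [← map_mul, ← map_sub, kdatA, EuclideanDomain.mul_div_cancel' hg hdvd]
  have hswap : ∑ i, ∑ j, polyToK Fq (A i j) * v i * polyToK Fq (lam j) =
      ∑ i, ∑ j, polyToK Fq (lam i * A i j) * v j := by
    rw [Finset.sum_comm]
    refine Finset.sum_congr rfl fun i _ => Finset.sum_congr rfl fun j _ => ?_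
    rw [hsym.apply, map_mul]
    ring
  have hexp : FAK Fq A (fun i => polyToK Fq g * v i + polyToK Fq (lam i)) =
      polyToK Fq g ^ 2 * FAK Fq A v +
        polyToK Fq g * (∑ i, ∑ j, polyToK Fq (A i j) * v i * polyToK Fq (lam j)) +
        polyToK Fq g * (∑ i, ∑ j, polyToK Fq (lam i * A i j) * v j) +
        polyToK Fq (FAP Fq A lam) := by
    simp only [FAK, FAP, map_sum, map_mul, Finset.mul_sum, ← Finset.sum_add_distrib]
    exact Finset.sum_congr rfl fun i _ => Finset.sum_congr rfl fun j _ => by ring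
  have hg' := polyToK_ne_zero hg
  rw [hexp, hswap, GfunA, mul_add, ← mul_assoc, pow_two, mul_assoc _ (polyToK Fq g) _⁻¹,
    mul_inv_cancel₀ hg', mul_one, mul_sub, hk]
  ring

lemma hwt_mul_wInd (hsym : A.IsSymm) {g f r : Polynomial Fq} (hg : g ≠ 0) (hf : f ≠ 0)
    (hr : r ≠ 0) {lam : Fin 4 → Polynomial Fq} (hdvd : g ∣ f - FAP Fq A lam)
    (v : Fin 4 → Kinf Fq) :
    hwt Fq (polyToK Fq r / tK Fq ^ Qdeg Fq f g)
        (GfunA Fq A g f lam v / tK Fq ^ (2 * Qdeg Fq f g)) *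
      wInd Fq f (fun i => polyToK Fq g * v i + polyToK Fq (lam i)) =
    {v : Fin 4 → Kinf Fq | (fun i => (tK Fq ^ (f.natDegree / 2))⁻¹ * polyToK Fq g * v i +
        (tK Fq ^ (f.natDegree / 2))⁻¹ * polyToK Fq (lam i)) ∈
      solSet A (normalized f) (r.natDegree + 4 - Qdeg Fq f g)}.indicator
        (fun _ => (Fintype.card Fq : ℝ) ^ (Qdeg Fq f g - r.natDegree)) v := by
  set d := f.natDegree / 2 with hd
  set Q := Qdeg Fq f g with hQ
  have hQd : Q = d - g.natDegree + 2 := by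
    rw [hQ, Qdeg, Rdeg]
    ring
  have ht : tK Fq ^ d ≠ 0 := pow_ne_zero _ tK_ne_zero
  have htinv : absK Fq (tK Fq ^ d)⁻¹ = (Fintype.card Fq : ℝ) ^ (-(d : ℤ)) := by
    rw [absK_inv, absK_pow, absK_tK, zpow_neg, zpow_natCast]
  have hrQ : absK Fq (polyToK Fq r / tK Fq ^ Q) = (Fintype.card Fq : ℝ) ^ (r.natDegree - Q) := by
    rw [absK_div, absK_polyToK hr, absK_zpow, absK_tK, zpow_sub₀ card_real_pos.ne']
  have hy : (fun i => (tK Fq ^ d)⁻¹ * polyToK Fq g * v i + (tK Fq ^ d)⁻¹ * polyToK Fq (lam i)) =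
      fun i => (tK Fq ^ d)⁻¹ * (polyToK Fq g * v i + polyToK Fq (lam i)) := by
    funext i
    ring
  have hbox : normV Fq (fun i => polyToK Fq g * v i + polyToK Fq (lam i)) ^ 2 ≤
      absK Fq (polyToK Fq f) ↔
        ∀ i, (tK Fq ^ d)⁻¹ * (polyToK Fq g * v i + polyToK Fq (lam i)) ∈ ballK Fq 1 := by
    simp only [normV_sq_le_iff hf, mul_mem_ballK_iff htinv, sub_neg_eq_add, ← hd]
  have hfac : absK Fq (((tK Fq ^ d)⁻¹ * polyToK Fq g * tK Fq ^ Q) ^ 2) =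
      (Fintype.card Fq : ℝ) ^ (4 : ℤ) := by
    rw [absK_pow, absK_mul, absK_mul, htinv, absK_polyToK hg, absK_zpow, absK_tK,
      ← zpow_add₀ card_real_pos.ne', ← zpow_add₀ card_real_pos.ne', ← zpow_natCast, ← zpow_mul, hQd]
    congr 1
    push_cast
    ring
  have hval : FAK Fq A (fun i => (tK Fq ^ d)⁻¹ * (polyToK Fq g * v i + polyToK Fq (lam i))) -
      normalized f = ((tK Fq ^ d)⁻¹ * polyToK Fq g * tK Fq ^ Q) ^ 2 *
        (GfunA Fq A g f lam v / tK Fq ^ (2 * Q)) := by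
    have htQ : tK Fq ^ Q ≠ 0 := zpow_ne_zero _ tK_ne_zero
    have hmul := sq_mul_GfunA hsym hg hdvd v
    rw [FAK_smul, normalized, ← hd, eq_add_of_sub_eq hmul.symm, mul_comm 2 Q, zpow_mul,
      mul_comm 2 d, pow_mul]
    norm_cast
    field_simp
    ring
  have hG : absK Fq (GfunA Fq A g f lam v / tK Fq ^ (2 * Q)) <
      (Fintype.card Fq : ℝ) ^ (r.natDegree - Q) ↔
      FAK Fq A (fun i => (tK Fq ^ d)⁻¹ * (polyToK Fq g * v i + polyToK Fq (lam i))) -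
        normalized f ∈ ballK Fq (r.natDegree + 4 - Q) := by
    rw [hval, mul_mem_ballK_iff hfac, mem_ballK]
    ring_nf
  have hmem : (fun i => (tK Fq ^ d)⁻¹ * (polyToK Fq g * v i + polyToK Fq (lam i))) ∈
      solSet A (normalized f) (r.natDegree + 4 - Q) ↔ _ ∧ _ := and_congr hbox.symm hG.symm
  simp only [Set.indicator_apply, Set.mem_ofPred_eq, hy, hmem, hwt, wInd, hrQ]
  rw [← zpow_neg, neg_sub]
  split_ifs <;> first | exact mul_one _ | simp; done | tauto

lemma psiK_zero : psiK Fq 0 = 1 := by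
  simp [psiK, eFq]

lemma IsHaar.IgrA_zero_eq (hμ : IsHaar Fq μ) (hsym : A.IsSymm) {g f r : Polynomial Fq}
    (hg : g ≠ 0) (hf : f ≠ 0) (hr : r ≠ 0) {lam : Fin 4 → Polynomial Fq}
    (hdvd : g ∣ f - FAP Fq A lam) :
    IgrA Fq μ A g f lam r 0 =
      (((Fintype.card Fq : ℝ) ^ (5 * Qdeg Fq f g - r.natDegree - 8) *
        (Measure.pi (fun _ : Fin 4 => μ)).real
          (solSet A (normalized f) (r.natDegree + 4 - Qdeg Fq f g)) : ℝ) : ℂ) := by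
  set Q := Qdeg Fq f g with hQ
  have ha : absK Fq ((tK Fq ^ (f.natDegree / 2))⁻¹ * polyToK Fq g) =
      (Fintype.card Fq : ℝ) ^ (2 - Q) := by
    rw [absK_mul, absK_inv, absK_pow, absK_tK, absK_polyToK hg, ← zpow_natCast, ← zpow_neg,
      ← zpow_add₀ card_real_pos.ne', hQ, Qdeg, Rdeg]
    congr 1
    ring
  have ha0 : (tK Fq ^ (f.natDegree / 2))⁻¹ * polyToK Fq g ≠ 0 :=
    mul_ne_zero (inv_ne_zero (pow_ne_zero _ tK_ne_zero)) (polyToK_ne_zero hg)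
  have hS := measurableSet_solSet (A := A) (normalized f) (r.natDegree + 4 - Q)
  have hmeas : Measurable fun (v : Fin 4 → Kinf Fq) i =>
      (tK Fq ^ (f.natDegree / 2))⁻¹ * polyToK Fq g * v i +
        (tK Fq ^ (f.natDegree / 2))⁻¹ * polyToK Fq (lam i) :=
    measurable_pi_lambda _ fun i => (measurable_mul_add ha0 _).comp (measurable_pi_apply i)
  have hmeasS := hmeas hS
  rw [Set.preimage] at hmeasS
  have hvol := hμ.pi_preimage_mul_add ha
    (fun i => (tK Fq ^ (f.natDegree / 2))⁻¹ * polyToK Fq (lam i)) hS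
  have hzero : ∀ v : Fin 4 → Kinf Fq, psiK Fq ((∑ i, polyToK Fq ((0 : Fin 4 → Polynomial Fq) i) *
      v i) / (polyToK Fq g * polyToK Fq r)) = 1 := fun v => by
    simp [psiK_zero]
  rw [IgrA]
  simp only [hzero, mul_one, ← hQ]
  rw [integral_complex_ofReal]
  simp only [hQ, hwt_mul_wInd hsym hg hf hr hdvd]
  rw [integral_indicator_const _ hmeasS, measureReal_def, ← hQ]
  congr 1
  erw [hvol]
  rw [ENNReal.toReal_mul, toReal_card_zpow, smul_eq_mul, mul_right_comm,
    ← zpow_add₀ card_real_pos.ne', measureReal_def]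
  congr 2
  ring

end Density

end LocalField

/-- **The main term `I_{g,r}(0⃗)`.** For a non-degenerate quaternary quadratic form `F` and
`ε > 0` there are a threshold `Q₀(ε,F)` and constants `C_ξ ≥ 0` indexed by the square classes
of `K_∞ˣ` such that for all delta-method data with `q^Q ≥ Q₀` and all monic `r` with
`1 ≤ |r| ≤ q^{Q(1−ε)}`, `I_{g,r}(0⃗) = C_ξ·q^{4Q}` where `ξ` is the class of `f`; and
`C_ξ > 0` whenever `F(x⃗) = f` has a solution over `K_∞` with `|x⃗|² ≤ |f|`. -/
theorem stmt_8 (hodd : Odd (Fintype.card Fq))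
    (μ : @Measure (Kinf Fq) (KinfMS Fq)) (hμ : IsHaar Fq μ)
    (A : Matrix (Fin 4) (Fin 4) (Polynomial Fq)) (hsym : A.IsSymm) (hdet : A.det ≠ 0)
    (ε : ℝ) (hε : 0 < ε) :
    ∃ (Q₀ : ℝ) (C : Polynomial Fq → ℝ),
      (∀ f, 0 ≤ C f) ∧
      (∀ f f' : Polynomial Fq, f ≠ 0 → f' ≠ 0 →
        (∃ u : Kinf Fq, u ≠ 0 ∧ polyToK Fq f = polyToK Fq f' * u ^ 2) → C f = C f') ∧
      (∀ f g : Polynomial Fq, f ≠ 0 → g ≠ 0 →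
        ∀ lam : Fin 4 → Polynomial Fq, (∀ i, (lam i).degree < g.degree) →
        g ∣ (f - FAP Fq A lam) →
        Q₀ ≤ (Fintype.card Fq : ℝ) ^ Qdeg Fq f g →
        ∀ r : Polynomial Fq, r.Monic →
          1 ≤ absK Fq (polyToK Fq r) →
          absK Fq (polyToK Fq r) ≤
            (Fintype.card Fq : ℝ) ^ ((Qdeg Fq f g : ℝ) * (1 - ε)) →
          IgrA Fq μ A g f lam r 0 =
            ((C f : ℝ) : ℂ) * (Fintype.card Fq : ℂ) ^ (4 * Qdeg Fq f g)) ∧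
      (∀ f : Polynomial Fq, f ≠ 0 →
        (∃ x : Fin 4 → Kinf Fq, FAK Fq A x = polyToK Fq f ∧
          (normV Fq x) ^ 2 ≤ absK Fq (polyToK Fq f)) → 0 < C f) := by
  let := KinfMS Fq
  have h2 : (2 : Fq) ≠ 0 := by
    refine Ring.two_ne_zero fun h => ?_
    have := FiniteField.even_card_of_char_two h
    rw [Nat.odd_iff] at hodd
    omega
  have hq := card_real_pos (Fq := Fq)
  refine ⟨(Fintype.card Fq : ℝ) ^ (4 / ε), fun f => (Fintype.card Fq : ℝ) ^ (-4 : ℤ) *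
    (Measure.pi (fun _ : Fin 4 => μ)).real (solSet A (normalized f) 0),
    fun f => mul_nonneg (zpow_nonneg hq.le _) measureReal_nonneg, ?_, ?_, ?_⟩
  · rintro f f' hf hf' ⟨u, hu, huf⟩
    obtain ⟨w, hw, hwf⟩ := exists_normalized_eq_mul_sq hf hf' hu huf
    simp only [hwf, measureReal_def, hμ.pi_solSet_mul_sq hw]
  · intro f g hf hg lam _ hdvd hQ r hr _ hrQ
    have hr0 := hr.ne_zero
    rw [← Real.rpow_intCast, Real.rpow_le_rpow_left_iff one_lt_card_real, div_le_iff₀ hε] at hQ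
    rw [absK_polyToK hr0, ← Real.rpow_intCast, Real.rpow_le_rpow_left_iff one_lt_card_real] at hrQ
    have hle : (r.natDegree : ℤ) + 4 ≤ Qdeg Fq f g := by
      have : ((r.natDegree : ℤ) : ℝ) + 4 ≤ Qdeg Fq f g := by linarith
      exact_mod_cast this
    obtain ⟨n, hn⟩ := Int.eq_ofNat_of_zero_le (sub_nonneg.2 hle)
    have hn' : (r.natDegree : ℤ) + 4 - Qdeg Fq f g = -(n : ℤ) := by omega
    have hexp : 5 * Qdeg Fq f g - r.natDegree - 8 + -(n : ℤ) = -4 + 4 * Qdeg Fq f g := by omega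
    rw [hμ.IgrA_zero_eq hsym hg hf hr0 hdvd, hn', measureReal_def,
      hμ.pi_solSet_neg_nat h2 (one_le_absK_normalized hf), ENNReal.toReal_mul, toReal_card_zpow,
      ← measureReal_def, ← mul_assoc, ← zpow_add₀ hq.ne', hexp, zpow_add₀ hq.ne']
    push_cast
    ring
  · rintro f hf ⟨x, hx, hxf⟩
    refine mul_pos (zpow_pos hq _) (ENNReal.toReal_pos ?_ (hμ.pi_solSet_ne_top _ _))
    refine (hμ.pi_solSet_pos ⟨fun i => (tK Fq ^ (f.natDegree / 2))⁻¹ * x i, fun i => ?_, ?_⟩).ne'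
    · have ht : absK Fq (tK Fq ^ (f.natDegree / 2))⁻¹ =
          (Fintype.card Fq : ℝ) ^ (-((f.natDegree / 2 : ℕ) : ℤ)) := by
        rw [absK_inv, absK_pow, absK_tK, zpow_neg, zpow_natCast]
      rw [mul_mem_ballK_iff ht, sub_neg_eq_add]
      exact (normV_sq_le_iff hf x).1 hxf i
    · rw [FAK_smul, hx, normalized, inv_pow, ← pow_mul, mul_comm (f.natDegree / 2) 2,
        inv_mul_eq_div, sub_self]
      exact zero_mem _

end
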